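/- Let k ∈ (1/2)ℤ with 0 < k < 4. For j ∈ {k, 4−k} set α(j) := (j+1)/6, and let f₁^{(j)}(τ) = g₁^{(j)}(e^{2πiτ}) and f₂^{(j)}(τ) = e^{2πiα(j)τ}·g₂^{(j)}(e^{2πiτ}) be the solutions of the Kaneko–Zagier equation of weight j, where g₁^{(j)}, g₂^{(j)} are holomorphic on the open unit disc with g₁^{(j)}(0) = g₂^{(j)}(0) = 1. Define the 2×2 matrices 𝓕^{(j)} := [[−2j·f₁^{(j)}, −2j·f₂^{(j)}], [∂_j f₁^{(j)}, ∂_j f₂^{(j)}]], C := [[−1/24, 0], [0, 1]], and M := [[E4², E6], [E6, E4]]. Then the duality identity (𝓕^{(k)})ᵀ · η⁻²⁴·C·M·C · 𝓕^{(4−k)} = [[12k(4−k), 0], [0, (k+1)(5−k)/36]] holds identically on ℍ. -/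

import Mathlib

open Complex

noncomputable section

/-- `q = e^{2πiτ}`. -/
def qexp (τ : ℂ) : ℂ := Complex.exp (2 * ↑Real.pi * Complex.I * τ)

/-- `q^s = e^{2πisτ}` for real `s`. -/
def qpow (s : ℝ) (τ : ℂ) : ℂ := Complex.exp (2 * ↑Real.pi * Complex.I * ↑s * τ)

/-- The differential operator `f' = (1/(2πi)) df/dτ` (i.e. `q d/dq`). -/
def Dq (f : ℂ → ℂ) : ℂ → ℂ := fun τ => deriv f τ / (2 * ↑Real.pi * Complex.I)

/-- The divisor power sum `σ_k(n)`. -/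
def sigma' (k n : ℕ) : ℕ := ∑ d ∈ n.divisors, d ^ k

/-- The quasimodular Eisenstein series `E₂`. -/
def E2 (τ : ℂ) : ℂ := 1 - 24 * ∑' n : ℕ, (sigma' 1 (n + 1) : ℂ) * qexp τ ^ (n + 1)

/-- The Eisenstein series `E₄`. -/
def E4 (τ : ℂ) : ℂ := 1 + 240 * ∑' n : ℕ, (sigma' 3 (n + 1) : ℂ) * qexp τ ^ (n + 1)

/-- The Eisenstein series `E₆`. -/
def E6 (τ : ℂ) : ℂ := 1 - 504 * ∑' n : ℕ, (sigma' 5 (n + 1) : ℂ) * qexp τ ^ (n + 1)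

/-- The Dedekind eta function `η(τ) = q^{1/24} ∏ (1 - qⁿ)`. -/
def η (τ : ℂ) : ℂ := qpow (1/24) τ * ∏' n : ℕ, (1 - qexp τ ^ (n + 1))

/-- Theta constant `θ₂(τ) = Σ_{n∈ℤ} q^{(n-1/2)²/2}`. -/
def θ₂ (τ : ℂ) : ℂ := ∑' n : ℤ, qpow (((n : ℝ) - 1/2) ^ 2 / 2) τ

/-- Theta constant `θ₃(τ) = Σ_{n∈ℤ} q^{n²/2}`. -/
def θ₃ (τ : ℂ) : ℂ := ∑' n : ℤ, qpow ((n : ℝ) ^ 2 / 2) τ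

/-- Theta constant `θ₄(τ) = Σ_{n∈ℤ} (-1)ⁿ q^{n²/2}`. -/
def θ₄ (τ : ℂ) : ℂ := ∑' n : ℤ, (-1 : ℂ) ^ n * qpow ((n : ℝ) ^ 2 / 2) τ

/-- `ξ₂ = 2 θ₂'/θ₂`. -/
def ξ₂ : ℂ → ℂ := fun τ => 2 * Dq θ₂ τ / θ₂ τ

/-- `ξ₃ = 2 θ₃'/θ₃`. -/
def ξ₃ : ℂ → ℂ := fun τ => 2 * Dq θ₃ τ / θ₃ τ

/-- `ξ₄ = 2 θ₄'/θ₄`. -/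
def ξ₄ : ℂ → ℂ := fun τ => 2 * Dq θ₄ τ / θ₄ τ

/-- `h₀ = 4ξ₂ - 2ξ₃ - 2ξ₄` (equal to `η⁴ χ_{Λ₀}^{q}`). -/
def h₀ : ℂ → ℂ := fun τ => 4 * ξ₂ τ - 2 * ξ₃ τ - 2 * ξ₄ τ

/-- `h₁ = 2ξ₃ - 2ξ₄` (equal to `η⁴ χ_{Λ₁}^{q}`). -/
def h₁ : ℂ → ℂ := fun τ => 2 * ξ₃ τ - 2 * ξ₄ τ

/-- The Serre-type derivative `∂_k f = f' - (k/12) E₂ f`. -/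
def partialD (k : ℂ) (f : ℂ → ℂ) : ℂ → ℂ := fun τ => Dq f τ - k / 12 * E2 τ * f τ

end

/-- `f` satisfies the Kaneko–Zagier equation of weight `k` on the upper half-plane:
`∂_{k+2}∂_k f = (k/12)((k+2)/12) E₄ f`. -/
def SatisfiesKZ (k : ℝ) (f : ℂ → ℂ) : Prop :=
  ∀ τ : ℂ, 0 < τ.im →
    partialD ((k : ℂ) + 2) (partialD (k : ℂ) f) τ =
      ((k : ℂ) / 12) * (((k : ℂ) + 2) / 12) * E4 τ * f τ


open Matrix

/-- The power series `∑_{n ≥ 1} σ_k(n) xⁿ`. -/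
noncomputable def sigmaSeries (k : ℕ) (x : ℂ) : ℂ := ∑' n : ℕ, (sigma' k (n + 1) : ℂ) * x ^ (n + 1)

lemma sigma'_eq_sigma (k n : ℕ) : sigma' k n = ArithmeticFunction.sigma k n := by
  rw [ArithmeticFunction.sigma_apply, sigma']

lemma differentiableOn_sigmaSeries (k : ℕ) :
    DifferentiableOn ℂ (sigmaSeries k) (Metric.ball 0 1) := by
  intro x hx
  obtain ⟨r, hxr, hr1⟩ := exists_between (mem_ball_zero_iff.mp hx)
  have hr0 : 0 ≤ r := (norm_nonneg x).trans hxr.le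
  have hu : Summable fun n : ℕ ↦ ((n + 1 : ℕ) : ℝ) ^ (k + 1) * r ^ (n + 1) :=
    (summable_nat_add_iff (f := fun n : ℕ ↦ (n : ℝ) ^ (k + 1) * r ^ n) 1).mpr
      (summable_pow_mul_geometric_of_norm_lt_one _ (by rwa [Real.norm_of_nonneg hr0]))
  have hd : DifferentiableOn ℂ (sigmaSeries k) (Metric.ball 0 r) := by
    refine Complex.differentiableOn_tsum_of_summable_norm hu (fun n ↦ by fun_prop)
      Metric.isOpen_ball fun n w hw ↦ ?_
    have hw' : ‖w‖ ≤ r := (mem_ball_zero_iff.mp hw).le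
    rw [norm_mul, norm_pow, Complex.norm_natCast]
    gcongr
    rw [sigma'_eq_sigma]
    exact_mod_cast ArithmeticFunction.sigma_le_pow_succ k (n + 1)
  exact (hd.differentiableAt (Metric.isOpen_ball.mem_nhds
    (mem_ball_zero_iff.mpr hxr))).differentiableWithinAt

lemma sigmaSeries_zero (k : ℕ) : sigmaSeries k 0 = 0 := by simp [sigmaSeries]

lemma E2_eq_sigmaSeries (τ : ℂ) : E2 τ = 1 - 24 * sigmaSeries 1 (qexp τ) := rfl

lemma E4_eq_sigmaSeries (τ : ℂ) : E4 τ = 1 + 240 * sigmaSeries 3 (qexp τ) := rfl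

lemma E6_eq_sigmaSeries (τ : ℂ) : E6 τ = 1 - 504 * sigmaSeries 5 (qexp τ) := rfl

lemma tsum_sigma_pnat (k : ℕ) (x : ℂ) :
    ∑' n : ℕ+, (ArithmeticFunction.sigma k n : ℂ) * x ^ (n : ℕ) = sigmaSeries k x := by
  rw [tsum_pnat_eq_tsum_succ (f := fun n : ℕ ↦ (ArithmeticFunction.sigma k n : ℂ) * x ^ n)]
  simp only [sigmaSeries, sigma'_eq_sigma]

lemma E2_coe (z : UpperHalfPlane) : EisensteinSeries.E2 z = E2 z := by
  rw [EisensteinSeries.E2_eq_tsum_cexp, tsum_sigma_pnat, E2_eq_sigmaSeries]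
  simp [qexp]

lemma E4_coe (z : UpperHalfPlane) : ModularForm.E₄ z = E4 z := by
  rw [EisensteinSeries.q_expansion_bernoulli (by norm_num) ⟨2, rfl⟩,
    show bernoulli 4 = -1 / 30 by decide +kernel, E4_eq_sigmaSeries, qexp, ← tsum_sigma_pnat]
  norm_num

lemma E6_coe (z : UpperHalfPlane) : ModularForm.E₆ z = E6 z := by
  rw [EisensteinSeries.q_expansion_bernoulli (by norm_num) ⟨3, rfl⟩,
    show bernoulli 6 = 1 / 42 by decide +kernel, E6_eq_sigmaSeries, qexp, ← tsum_sigma_pnat]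
  norm_num

lemma eta_coe (τ : ℂ) : ModularForm.eta τ = η τ := by
  simp [ModularForm.eta, η, ModularForm.eta_q, Function.Periodic.qParam, qexp, qpow]
  left
  ring_nf

lemma norm_qexp_lt_one {τ : ℂ} (hτ : 0 < τ.im) : ‖qexp τ‖ < 1 :=
  UpperHalfPlane.norm_exp_two_pi_I_lt_one ⟨τ, hτ⟩

lemma qexp_mem_ball {τ : ℂ} (hτ : 0 < τ.im) : qexp τ ∈ Metric.ball (0 : ℂ) 1 :=
  mem_ball_zero_iff.mpr (norm_qexp_lt_one hτ)

lemma hasDerivAt_qexp (τ : ℂ) :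
    HasDerivAt qexp (2 * Real.pi * Complex.I * qexp τ) τ := by
  change HasDerivAt (fun t ↦ Complex.exp (2 * Real.pi * Complex.I * t)) _ τ
  exact ((hasDerivAt_id τ).const_mul (2 * Real.pi * Complex.I)).cexp.congr_deriv
    (by rw [qexp]; simp; ring)

lemma hasDerivAt_qpow (s : ℝ) (τ : ℂ) :
    HasDerivAt (qpow s) (2 * Real.pi * Complex.I * s * qpow s τ) τ := by
  change HasDerivAt (fun t ↦ Complex.exp (2 * Real.pi * Complex.I * s * t)) _ τ
  exact ((hasDerivAt_id τ).const_mul (2 * Real.pi * Complex.I * s)).cexp.congr_deriv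
    (by rw [qpow]; simp; ring)

lemma hasDerivAt_comp_qexp {P : ℂ → ℂ} (hP : DifferentiableOn ℂ P (Metric.ball 0 1))
    {τ : ℂ} (hτ : 0 < τ.im) :
    HasDerivAt (fun t ↦ P (qexp t)) (2 * Real.pi * Complex.I * (qexp τ * deriv P (qexp τ))) τ := by
  have h := (hP.differentiableAt (Metric.isOpen_ball.mem_nhds (qexp_mem_ball hτ))).hasDerivAt
  exact (h.comp τ (hasDerivAt_qexp τ)).congr_deriv (by ring)

lemma hasDerivAt_qpow_mul {P : ℂ → ℂ} (hP : DifferentiableOn ℂ P (Metric.ball 0 1)) (s : ℝ)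
    {τ : ℂ} (hτ : 0 < τ.im) :
    HasDerivAt (fun t ↦ qpow s t * P (qexp t))
      (2 * Real.pi * Complex.I *
        (qpow s τ * (s * P (qexp τ) + qexp τ * deriv P (qexp τ)))) τ := by
  exact ((hasDerivAt_qpow s τ).mul (hasDerivAt_comp_qexp hP hτ)).congr_deriv (by ring)

lemma Dq_eq_of_hasDerivAt {f : ℂ → ℂ} {τ d : ℂ}
    (h : HasDerivAt f (2 * Real.pi * Complex.I * d) τ) : Dq f τ = d := by
  rw [Dq, h.deriv, mul_div_cancel_left₀ _ Complex.two_pi_I_ne_zero]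

open scoped MatrixGroups ModularForm Topology Manifold in
/-- A holomorphic function on the upper half-plane that is invariant of weight `k < 12` under
`SL(2, ℤ)` and tends to zero at infinity vanishes. -/
lemma eq_zero_of_slash_invariant_of_tendsto_zero {k : ℤ} (hk : k < 12) {F : UpperHalfPlane → ℂ}
    (hF : MDiff F) (hinv : ∀ γ : SL(2, ℤ), F ∣[k] γ = F)
    (hlim : Filter.Tendsto F UpperHalfPlane.atImInfty (𝓝 0)) : F = 0 := by
  let f : CuspForm 𝒮ℒ k :=
    { toFun := F
      slash_action_eq' := fun _ ⟨γ, hγ⟩ ↦ hγ ▸ hinv γ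
      holo' := hF
      zero_at_cusps' := fun hc ↦ by
        rw [Subgroup.IsArithmetic.isCusp_iff_isCusp_SL2Z] at hc
        rw [OnePoint.isZeroAt_iff_forall_SL2Z hc]
        intro γ _
        rw [hinv]
        exact hlim }
  have hf : f = 0 := rank_zero_iff_forall_zero.mp (CuspForm.rank_eq_zero_of_weight_lt_twelve hk) f
  exact congrArg DFunLike.coe hf

lemma tendsto_qexp_atImInfty :
    Filter.Tendsto (fun z : UpperHalfPlane ↦ qexp z) UpperHalfPlane.atImInfty (nhds 0) := by
  simpa [Function.Periodic.qParam, qexp] using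
    UpperHalfPlane.qParam_tendsto_atImInfty (h := 1) one_pos

lemma tendsto_comp_qexp_atImInfty {P : ℂ → ℂ} (hP : ContinuousAt P 0) :
    Filter.Tendsto (fun z : UpperHalfPlane ↦ P (qexp z)) UpperHalfPlane.atImInfty (nhds (P 0)) :=
  hP.tendsto.comp tendsto_qexp_atImInfty

lemma continuousAt_zero_of_differentiableOn_ball {P : ℂ → ℂ}
    (hP : DifferentiableOn ℂ P (Metric.ball 0 1)) : ContinuousAt P 0 :=
  (hP.differentiableAt (Metric.ball_mem_nhds 0 one_pos)).continuousAt

lemma differentiableOn_deriv_ball {P : ℂ → ℂ}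
    (hP : DifferentiableOn ℂ P (Metric.ball 0 1)) :
    DifferentiableOn ℂ (deriv P) (Metric.ball 0 1) :=
  hP.deriv Metric.isOpen_ball

lemma deriv_comp_ofComplex {F : UpperHalfPlane → ℂ} {f : ℂ → ℂ}
    (h : ∀ z : UpperHalfPlane, F z = f z) (z : UpperHalfPlane) :
    Derivative.normalizedDerivOfComplex F z = Dq f z := by
  have heq : F ∘ UpperHalfPlane.ofComplex =ᶠ[nhds (z : ℂ)] f := by
    filter_upwards [UpperHalfPlane.isOpen_upperHalfPlaneSet.mem_nhds z.2] with w hw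
    simp [h, UpperHalfPlane.ofComplex_apply_of_im_pos hw]
  rw [Derivative.normalizedDerivOfComplex, heq.deriv_eq, Dq, div_eq_inv_mul]

lemma serreDerivative_eq_partialD {F : UpperHalfPlane → ℂ} {f : ℂ → ℂ}
    (h : ∀ z : UpperHalfPlane, F z = f z) (k : ℂ) (z : UpperHalfPlane) :
    Derivative.serreDerivative k F z = partialD k f z := by
  rw [Derivative.serreDerivative_apply, deriv_comp_ofComplex h, partialD, E2_coe, h]
  ring

/-- `1 - 24 ∑ σ₁(n) xⁿ`, the expansion of `E₂`. -/
noncomputable def E2Series (x : ℂ) : ℂ := 1 - 24 * sigmaSeries 1 x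

/-- `1 + 240 ∑ σ₃(n) xⁿ`, the expansion of `E₄`. -/
noncomputable def E4Series (x : ℂ) : ℂ := 1 + 240 * sigmaSeries 3 x

/-- `1 - 504 ∑ σ₅(n) xⁿ`, the expansion of `E₆`. -/
noncomputable def E6Series (x : ℂ) : ℂ := 1 - 504 * sigmaSeries 5 x

lemma differentiableOn_E2Series : DifferentiableOn ℂ E2Series (Metric.ball 0 1) :=
  ((differentiableOn_sigmaSeries 1).const_mul 24).const_sub 1

lemma differentiableOn_E4Series : DifferentiableOn ℂ E4Series (Metric.ball 0 1) :=
  ((differentiableOn_sigmaSeries 3).const_mul 240).const_add 1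

lemma differentiableOn_E6Series : DifferentiableOn ℂ E6Series (Metric.ball 0 1) :=
  ((differentiableOn_sigmaSeries 5).const_mul 504).const_sub 1

lemma E2Series_zero : E2Series 0 = 1 := by simp [E2Series, sigmaSeries_zero]

lemma E4Series_zero : E4Series 0 = 1 := by simp [E4Series, sigmaSeries_zero]

lemma E6Series_zero : E6Series 0 = 1 := by simp [E6Series, sigmaSeries_zero]

/-- The power series in `q` of `q^{-s} ∂_k (q^s P(q))`. -/
noncomputable def serreSeries (k s : ℂ) (P : ℂ → ℂ) (x : ℂ) : ℂ :=
  s * P x + x * deriv P x - k / 12 * E2Series x * P x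

lemma differentiableOn_serreSeries (k s : ℂ) {P : ℂ → ℂ}
    (hP : DifferentiableOn ℂ P (Metric.ball 0 1)) :
    DifferentiableOn ℂ (serreSeries k s P) (Metric.ball 0 1) :=
  ((hP.const_mul s).add (differentiableOn_id.mul (differentiableOn_deriv_ball hP))).sub
    ((differentiableOn_E2Series.const_mul (k / 12)).mul hP)

lemma serreSeries_zero (k s : ℂ) (P : ℂ → ℂ) : serreSeries k s P 0 = (s - k / 12) * P 0 := by
  rw [serreSeries, E2Series_zero]
  ring

lemma partialD_comp_qexp (k : ℂ) {P : ℂ → ℂ} (hP : DifferentiableOn ℂ P (Metric.ball 0 1))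
    {τ : ℂ} (hτ : 0 < τ.im) :
    partialD k (fun t ↦ P (qexp t)) τ = serreSeries k 0 P (qexp τ) := by
  rw [partialD, Dq_eq_of_hasDerivAt (hasDerivAt_comp_qexp hP hτ), serreSeries, E2Series,
    E2_eq_sigmaSeries]
  ring

lemma partialD_qpow_mul (k : ℂ) {P : ℂ → ℂ} (hP : DifferentiableOn ℂ P (Metric.ball 0 1)) (s : ℝ)
    {τ : ℂ} (hτ : 0 < τ.im) :
    partialD k (fun t ↦ qpow s t * P (qexp t)) τ = qpow s τ * serreSeries k s P (qexp τ) := by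
  rw [partialD, Dq_eq_of_hasDerivAt (hasDerivAt_qpow_mul hP s hτ), serreSeries, E2Series,
    E2_eq_sigmaSeries]
  ring

open scoped MatrixGroups ModularForm Topology Manifold in
/-- The Serre derivative of a level one modular form `f` of weight `k < 10` is determined by its
value at infinity. -/
lemma partialD_eq_of_tendsto {k : ℤ} (hk : k < 10) (f : ModularForm 𝒮ℒ k)
    (g : ModularForm 𝒮ℒ (k + 2)) {P Q : ℂ → ℂ}
    (hP : DifferentiableOn ℂ P (Metric.ball 0 1)) (hQ : DifferentiableOn ℂ Q (Metric.ball 0 1))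
    (hf : ∀ z : UpperHalfPlane, f z = P (qexp z)) (hg : ∀ z : UpperHalfPlane, g z = Q (qexp z))
    (h0 : Q 0 = -(k / 12) * P 0) {τ : ℂ} (hτ : 0 < τ.im) :
    partialD k (fun t ↦ P (qexp t)) τ = Q (qexp τ) := by
  have hslash {m : ℤ} (h : ModularForm 𝒮ℒ m) (γ : SL(2, ℤ)) : ⇑h ∣[m] γ = ⇑h :=
    h.slash_action_eq' _ ⟨γ, rfl⟩
  have hS (z : UpperHalfPlane) : Derivative.serreDerivative k f z =
      serreSeries k 0 P (qexp z) := by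
    rw [serreDerivative_eq_partialD (f := fun t ↦ P (qexp t)) hf, partialD_comp_qexp _ hP z.2]
  have hzero : Derivative.serreDerivative k f - g = 0 := by
    refine eq_zero_of_slash_invariant_of_tendsto_zero (k := k + 2) (by lia)
      ((Derivative.serreDerivative_mdifferentiable _ f.holo').sub g.holo') (fun γ ↦ ?_) ?_
    · have h := Derivative.serreDerivative_slash_invariant f.holo' (hslash f γ)
      rw [sub_eq_add_neg, SlashAction.add_slash, SlashAction.neg_slash, hslash g]
      exact congrArg (· + -⇑g) h
    · have hlim := (tendsto_comp_qexp_atImInfty (continuousAt_zero_of_differentiableOn_ball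
        (differentiableOn_serreSeries k 0 hP))).sub
        (tendsto_comp_qexp_atImInfty (continuousAt_zero_of_differentiableOn_ball hQ))
      rw [serreSeries_zero, h0, zero_sub, sub_self] at hlim
      exact hlim.congr fun z ↦ by rw [Pi.sub_apply, hS, hg]
  have h := congrFun hzero ⟨τ, hτ⟩
  rw [Pi.sub_apply, hS, hg, Pi.zero_apply, sub_eq_zero] at h
  rw [partialD_comp_qexp _ hP hτ]
  exact h

/-- Ramanujan's identity for `E₄'`. -/
lemma Dq_E4 {τ : ℂ} (hτ : 0 < τ.im) : Dq E4 τ = (E2 τ * E4 τ - E6 τ) / 3 := by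
  have h := partialD_eq_of_tendsto (k := 4) (by norm_num) ModularForm.E₄
    ((-1 / 3 : ℂ) • ModularForm.E₆) differentiableOn_E4Series
    (differentiableOn_E6Series.const_mul (-1 / 3)) E4_coe
    (fun z ↦ congrArg ((-1 / 3 : ℂ) * ·) (E6_coe z))
    (by rw [E4Series_zero, E6Series_zero]; norm_num) hτ
  change Dq E4 τ - ((4 : ℤ) : ℂ) / 12 * E2 τ * E4 τ = -1 / 3 * E6 τ at h
  push_cast at h
  linear_combination h

/-- Ramanujan's identity for `E₆'`. -/
lemma Dq_E6 {τ : ℂ} (hτ : 0 < τ.im) : Dq E6 τ = (E2 τ * E6 τ - E4 τ ^ 2) / 2 := by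
  have h := partialD_eq_of_tendsto (k := 6) (by norm_num) ModularForm.E₆
    ((-1 / 2 : ℂ) • (ModularForm.E₄.mul ModularForm.E₄)) differentiableOn_E6Series
    ((differentiableOn_E4Series.pow 2).const_mul (-1 / 2)) E6_coe
    (fun z ↦ by
      change (-1 / 2 : ℂ) * (ModularForm.E₄ z * ModularForm.E₄ z) = -1 / 2 * E4 z ^ 2
      rw [E4_coe]
      ring)
    (by norm_num [E4Series_zero, E6Series_zero]) hτ
  change Dq E6 τ - ((6 : ℤ) : ℂ) / 12 * E2 τ * E6 τ = -1 / 2 * E4 τ ^ 2 at h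
  push_cast at h
  linear_combination h

lemma differentiableAt_E4 {τ : ℂ} (hτ : 0 < τ.im) : DifferentiableAt ℂ E4 τ :=
  (hasDerivAt_comp_qexp differentiableOn_E4Series hτ).differentiableAt

lemma differentiableAt_E6 {τ : ℂ} (hτ : 0 < τ.im) : DifferentiableAt ℂ E6 τ :=
  (hasDerivAt_comp_qexp differentiableOn_E6Series hτ).differentiableAt

lemma E4_cube_sub_E6_sq {τ : ℂ} (hτ : 0 < τ.im) : E4 τ ^ 3 - E6 τ ^ 2 = 1728 * η τ ^ 24 := by
  have h : ModularForm.eta τ ^ 24 = _ :=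
    ModularForm.discriminant_eq_E₄_cube_sub_E₆_sq ⟨τ, hτ⟩
  rw [E4_coe, E6_coe, eta_coe] at h
  rw [h]
  ring

lemma differentiableAt_qpow_mul {P : ℂ → ℂ} (hP : DifferentiableOn ℂ P (Metric.ball 0 1)) (s : ℝ)
    {τ : ℂ} (hτ : 0 < τ.im) : DifferentiableAt ℂ (fun t ↦ qpow s t * P (qexp t)) τ :=
  (hasDerivAt_qpow_mul hP s hτ).differentiableAt

lemma differentiableAt_partialD_qpow_mul (k : ℂ) {P : ℂ → ℂ}
    (hP : DifferentiableOn ℂ P (Metric.ball 0 1)) (s : ℝ) {τ : ℂ} (hτ : 0 < τ.im) :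
    DifferentiableAt ℂ (partialD k (fun t ↦ qpow s t * P (qexp t))) τ := by
  refine (differentiableAt_qpow_mul (differentiableOn_serreSeries k s hP) s hτ).congr_of_eventuallyEq
    ?_
  filter_upwards [UpperHalfPlane.isOpen_upperHalfPlaneSet.mem_nhds hτ] with w hw
  exact partialD_qpow_mul k hP s hw

lemma hasDerivAt_of_Dq {f : ℂ → ℂ} {τ d : ℂ} (hf : DifferentiableAt ℂ f τ) (h : Dq f τ = d) :
    HasDerivAt f (2 * Real.pi * Complex.I * d) τ := by
  rw [← h, Dq, mul_div_cancel₀ _ Complex.two_pi_I_ne_zero]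
  exact hf.hasDerivAt

lemma Dq_eq_partialD_add (k : ℂ) (f : ℂ → ℂ) (τ : ℂ) :
    Dq f τ = partialD k f τ + k / 12 * E2 τ * f τ := by
  rw [partialD]
  ring

/-- The bilinear form pairing solutions of the Kaneko–Zagier equations of weights `k` and `l`. -/
noncomputable def dualityForm (k l : ℂ) (f g : ℂ → ℂ) (τ : ℂ) : ℂ :=
  k * l / 144 * E4 τ ^ 2 * f τ * g τ + k / 12 * E6 τ * f τ * partialD l g τ +
    l / 12 * E6 τ * partialD k f τ * g τ + E4 τ * partialD k f τ * partialD l g τ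

lemma eta_ne_zero {τ : ℂ} (hτ : 0 < τ.im) : η τ ≠ 0 := by
  rw [← eta_coe]
  exact ModularForm.eta_ne_zero hτ

/-- The duality form of two solutions of weights `k` and `4 - k` is a multiple of `η²⁴`. -/
lemma exists_dualityForm_eq {k l : ℝ} (hkl : k + l = 4) {f g : ℂ → ℂ}
    (hf : ∀ τ : ℂ, 0 < τ.im → DifferentiableAt ℂ f τ)
    (hf' : ∀ τ : ℂ, 0 < τ.im → DifferentiableAt ℂ (partialD k f) τ)
    (hg : ∀ τ : ℂ, 0 < τ.im → DifferentiableAt ℂ g τ)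
    (hg' : ∀ τ : ℂ, 0 < τ.im → DifferentiableAt ℂ (partialD l g) τ)
    (hfk : SatisfiesKZ k f) (hgl : SatisfiesKZ l g) :
    ∃ c : ℂ, ∀ τ : ℂ, 0 < τ.im → dualityForm k l f g τ = c * η τ ^ 24 := by
  have hl : (l : ℂ) = 4 - k := by
    rw [show l = 4 - k by linarith]
    push_cast
    ring
  have hΔ (τ : ℂ) (hτ : 0 < τ.im) : E4 τ ^ 3 - E6 τ ^ 2 ≠ 0 := by
    rw [E4_cube_sub_E6_sq hτ]
    exact mul_ne_zero (by norm_num) (pow_ne_zero _ (eta_ne_zero hτ))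
  have hderiv (τ : ℂ) (hτ : 0 < τ.im) :
      HasDerivAt (fun z ↦ dualityForm k l f g z / (E4 z ^ 3 - E6 z ^ 2)) 0 τ := by
    have h4 := hasDerivAt_of_Dq (differentiableAt_E4 hτ) (Dq_E4 hτ)
    have h6 := hasDerivAt_of_Dq (differentiableAt_E6 hτ) (Dq_E6 hτ)
    have h1 := hasDerivAt_of_Dq (hf τ hτ) (Dq_eq_partialD_add k f τ)
    have h2 := hasDerivAt_of_Dq (hg τ hτ) (Dq_eq_partialD_add l g τ)
    have h3 := hasDerivAt_of_Dq (hf' τ hτ) (Dq_eq_partialD_add (k + 2) (partialD k f) τ)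
    have h5 := hasDerivAt_of_Dq (hg' τ hτ) (Dq_eq_partialD_add (l + 2) (partialD l g) τ)
    rw [hfk τ hτ] at h3
    rw [hgl τ hτ] at h5
    have hN : HasDerivAt (dualityForm k l f g)
        (2 * Real.pi * Complex.I * (E2 τ * dualityForm k l f g τ)) τ := by
      refine (((((((h4.pow 2).const_mul (k * l / 144 : ℂ)).mul h1).mul h2).add
        (((h6.const_mul (k / 12 : ℂ)).mul h1).mul h5)).add
        (((h6.const_mul (l / 12 : ℂ)).mul h3).mul h2)).add
        ((h4.mul h3).mul h5)).congr_deriv ?_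
      simp only [dualityForm, Pi.mul_apply, Pi.pow_apply]
      rw [hl]
      push_cast
      ring
    have hD : HasDerivAt (fun z ↦ E4 z ^ 3 - E6 z ^ 2)
        (2 * Real.pi * Complex.I * (E2 τ * (E4 τ ^ 3 - E6 τ ^ 2))) τ := by
      refine ((h4.pow 3).sub (h6.pow 2)).congr_deriv ?_
      push_cast
      ring
    refine (hN.div hD (hΔ τ hτ)).congr_deriv ?_
    ring_nf
  have hconst (τ : ℂ) (hτ : 0 < τ.im) :
      dualityForm k l f g τ / (E4 τ ^ 3 - E6 τ ^ 2) =
        dualityForm k l f g Complex.I / (E4 Complex.I ^ 3 - E6 Complex.I ^ 2) :=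
    UpperHalfPlane.isOpen_upperHalfPlaneSet.is_const_of_deriv_eq_zero
      (convex_halfSpace_im_gt 0).isPreconnected
      (fun z hz ↦ (hderiv z hz).differentiableAt.differentiableWithinAt)
      (fun z hz ↦ (hderiv z hz).deriv) hτ (by simp : (0 : ℝ) < Complex.I.im)
  refine ⟨1728 * (dualityForm k l f g Complex.I / (E4 Complex.I ^ 3 - E6 Complex.I ^ 2)),
    fun τ hτ ↦ ?_⟩
  rw [← hconst τ hτ]
  have h := hΔ τ hτ
  rw [E4_cube_sub_E6_sq hτ] at h ⊢
  have hη := eta_ne_zero hτ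
  field_simp

/-- The expansion of `η²⁴ / q`. -/
noncomputable def discSeries (x : ℂ) : ℂ := (∏' n : ℕ, (1 - x ^ (n + 1))) ^ 24

lemma differentiableOn_discSeries : DifferentiableOn ℂ discSeries (Metric.ball 0 1) :=
  ModularForm.differentiableOn_tprod_one_sub_pow.pow 24

lemma discSeries_zero : discSeries 0 = 1 := by simp [discSeries]

lemma eta_pow_eq (τ : ℂ) : η τ ^ 24 = qexp τ * discSeries (qexp τ) := by
  rw [η, mul_pow, discSeries, qpow, ← Complex.exp_nat_mul, qexp]
  congr 2
  push_cast
  ring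

lemma qexp_ne_zero (τ : ℂ) : qexp τ ≠ 0 := Complex.exp_ne_zero _

lemma qpow_zero (τ : ℂ) : qpow 0 τ = 1 := by simp [qpow]

lemma qpow_one (τ : ℂ) : qpow 1 τ = qexp τ := by simp [qpow, qexp]

lemma qpow_add (s t : ℝ) (τ : ℂ) : qpow (s + t) τ = qpow s τ * qpow t τ := by
  rw [qpow, qpow, qpow, ← Complex.exp_add]
  push_cast
  ring_nf

lemma tendsto_qpow_atImInfty {s : ℝ} (hs : 0 < s) :
    Filter.Tendsto (fun z : UpperHalfPlane ↦ qpow s z) UpperHalfPlane.atImInfty (nhds 0) := by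
  refine (UpperHalfPlane.qParam_tendsto_atImInfty (h := s⁻¹) (inv_pos.mpr hs)).congr fun z ↦ ?_
  rw [Function.Periodic.qParam, qpow]
  push_cast
  congr 1
  field_simp

/-- The expansion of `q^{-s} (E₄ ∂_k f + (k/12) E₆ f)` for `f = q^s P(q)`. -/
noncomputable def auxSeries (k s : ℂ) (P : ℂ → ℂ) (x : ℂ) : ℂ :=
  E4Series x * serreSeries k s P x + k / 12 * E6Series x * P x

lemma differentiableOn_auxSeries (k s : ℂ) {P : ℂ → ℂ}
    (hP : DifferentiableOn ℂ P (Metric.ball 0 1)) :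
    DifferentiableOn ℂ (auxSeries k s P) (Metric.ball 0 1) :=
  (differentiableOn_E4Series.mul (differentiableOn_serreSeries k s hP)).add
    ((differentiableOn_E6Series.const_mul (k / 12)).mul hP)

lemma auxSeries_zero (k s : ℂ) (P : ℂ → ℂ) : auxSeries k s P 0 = s * P 0 := by
  rw [auxSeries, E4Series_zero, E6Series_zero, serreSeries_zero]
  ring

lemma E4_mul_dualityForm (k l : ℂ) {P R : ℂ → ℂ}
    (hP : DifferentiableOn ℂ P (Metric.ball 0 1)) (hR : DifferentiableOn ℂ R (Metric.ball 0 1))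
    (s t : ℝ) {τ : ℂ} (hτ : 0 < τ.im) :
    E4 τ * dualityForm k l (fun t ↦ qpow s t * P (qexp t)) (fun z ↦ qpow t z * R (qexp z)) τ =
      qpow (s + t) τ * (auxSeries k s P (qexp τ) * auxSeries l t R (qexp τ)) +
        12 * k * l * qpow (s + t) τ * (P (qexp τ) * R (qexp τ)) * η τ ^ 24 := by
  have h := E4_cube_sub_E6_sq hτ
  rw [dualityForm, partialD_qpow_mul k hP s hτ, partialD_qpow_mul l hR t hτ, qpow_add, auxSeries,
    auxSeries]
  change _ = qpow s τ * qpow t τ * ((E4 τ * _ + k / 12 * E6 τ * _) *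
    (E4 τ * _ + l / 12 * E6 τ * _)) + _
  linear_combination k * l / 144 * qpow s τ * qpow t τ * P (qexp τ) * R (qexp τ) * h

/-- The identity governing the constant of `exists_dualityForm_eq`. -/
lemma exists_dualityForm_qpow_eq {k l : ℝ} (hkl : k + l = 4) {s t : ℝ} {P R : ℂ → ℂ}
    (hP : DifferentiableOn ℂ P (Metric.ball 0 1)) (hR : DifferentiableOn ℂ R (Metric.ball 0 1))
    (hPk : SatisfiesKZ k (fun τ ↦ qpow s τ * P (qexp τ)))
    (hRl : SatisfiesKZ l (fun τ ↦ qpow t τ * R (qexp τ))) :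
    ∃ c : ℂ, ∀ τ : ℂ, 0 < τ.im →
      dualityForm k l (fun z ↦ qpow s z * P (qexp z)) (fun z ↦ qpow t z * R (qexp z)) τ =
          c * η τ ^ 24 ∧
      c * (E4Series (qexp τ) * discSeries (qexp τ)) =
        qpow (s + t) τ / qexp τ * (auxSeries k s P (qexp τ) * auxSeries l t R (qexp τ)) +
          qpow (s + t) τ *
            (12 * k * l * (P (qexp τ) * R (qexp τ) * discSeries (qexp τ))) := by
  obtain ⟨c, hc⟩ := exists_dualityForm_eq hkl (fun τ hτ ↦ differentiableAt_qpow_mul hP s hτ)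
    (fun τ hτ ↦ differentiableAt_partialD_qpow_mul k hP s hτ)
    (fun τ hτ ↦ differentiableAt_qpow_mul hR t hτ)
    (fun τ hτ ↦ differentiableAt_partialD_qpow_mul l hR t hτ) hPk hRl
  refine ⟨c, fun τ hτ ↦ ⟨hc τ hτ, ?_⟩⟩
  have h := E4_mul_dualityForm k l hP hR s t hτ
  rw [hc τ hτ, eta_pow_eq, show E4 τ = E4Series (qexp τ) from rfl] at h
  have hq := qexp_ne_zero τ
  field_simp
  linear_combination h

lemma tendsto_E4Series_mul_discSeries :
    Filter.Tendsto (fun z : UpperHalfPlane ↦ E4Series (qexp z) * discSeries (qexp z))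
      UpperHalfPlane.atImInfty (nhds 1) := by
  simpa [E4Series_zero, discSeries_zero] using tendsto_comp_qexp_atImInfty
    (continuousAt_zero_of_differentiableOn_ball
      (differentiableOn_E4Series.mul differentiableOn_discSeries))

/-- If the exponents add up to one, the constant is their product. -/
lemma dualityForm_eq_of_add_eq_one {k l : ℝ} (hkl : k + l = 4) {s t : ℝ} (hst : s + t = 1)
    {P R : ℂ → ℂ}
    (hP : DifferentiableOn ℂ P (Metric.ball 0 1)) (hR : DifferentiableOn ℂ R (Metric.ball 0 1))
    (hP0 : P 0 = 1) (hR0 : R 0 = 1)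
    (hPk : SatisfiesKZ k (fun τ ↦ qpow s τ * P (qexp τ)))
    (hRl : SatisfiesKZ l (fun τ ↦ qpow t τ * R (qexp τ))) {τ : ℂ} (hτ : 0 < τ.im) :
    dualityForm k l (fun z ↦ qpow s z * P (qexp z)) (fun z ↦ qpow t z * R (qexp z)) τ =
      s * t * η τ ^ 24 := by
  obtain ⟨c, hc⟩ := exists_dualityForm_qpow_eq hkl hP hR hPk hRl
  have hlim := (tendsto_comp_qexp_atImInfty (continuousAt_zero_of_differentiableOn_ball
    ((differentiableOn_auxSeries k s hP).mul (differentiableOn_auxSeries l t hR)))).add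
    (tendsto_qexp_atImInfty.mul (tendsto_comp_qexp_atImInfty
      (continuousAt_zero_of_differentiableOn_ball
        (((hP.mul hR).mul differentiableOn_discSeries).const_mul (12 * k * l)))))
  have heq := tendsto_nhds_unique (tendsto_E4Series_mul_discSeries.const_mul c)
    (hlim.congr fun z ↦ by
      rw [(hc z z.2).2, hst, qpow_one, div_self (qexp_ne_zero _), one_mul]
      rfl)
  rw [Pi.mul_apply, auxSeries_zero, auxSeries_zero, hP0, hR0] at heq
  rw [(hc τ hτ).1, show c = s * t by linear_combination heq]

/-- If one exponent is zero, the constant is read off from a quotient by `q`. -/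
lemma exists_dualityForm_qpow_eq_of_mul_eq_zero {k l : ℝ} (hkl : k + l = 4) {s t : ℝ}
    (hst : s * t = 0) {P R : ℂ → ℂ}
    (hP : DifferentiableOn ℂ P (Metric.ball 0 1)) (hR : DifferentiableOn ℂ R (Metric.ball 0 1))
    (hPk : SatisfiesKZ k (fun τ ↦ qpow s τ * P (qexp τ)))
    (hRl : SatisfiesKZ l (fun τ ↦ qpow t τ * R (qexp τ))) {a : ℂ}
    (ha : Filter.Tendsto (fun z : UpperHalfPlane ↦ qpow (s + t) z) UpperHalfPlane.atImInfty
      (nhds a)) {τ : ℂ} (hτ : 0 < τ.im) :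
    dualityForm k l (fun z ↦ qpow s z * P (qexp z)) (fun z ↦ qpow t z * R (qexp z)) τ =
      a * (deriv (auxSeries k s P * auxSeries l t R) 0 + 12 * k * l * (P 0 * R 0)) *
        η τ ^ 24 := by
  obtain ⟨c, hc⟩ := exists_dualityForm_qpow_eq hkl hP hR hPk hRl
  set A := auxSeries k s P * auxSeries l t R with hA
  have hAd : DifferentiableOn ℂ A (Metric.ball 0 1) :=
    (differentiableOn_auxSeries k s hP).mul (differentiableOn_auxSeries l t hR)
  have hA0 : A 0 = 0 := by
    rw [hA, Pi.mul_apply, auxSeries_zero, auxSeries_zero]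
    have : (s : ℂ) * t = 0 := by exact_mod_cast hst
    linear_combination P 0 * R 0 * this
  have hslope := (Complex.differentiableOn_dslope (Metric.ball_mem_nhds (0 : ℂ) one_pos)).mpr hAd
  have hlim := ha.mul (tendsto_comp_qexp_atImInfty (continuousAt_zero_of_differentiableOn_ball
    (hslope.add (((hP.mul hR).mul differentiableOn_discSeries).const_mul (12 * k * l)))))
  have heq := tendsto_nhds_unique (tendsto_E4Series_mul_discSeries.const_mul c)
    (hlim.congr fun z ↦ by
      have hq := qexp_ne_zero z
      have h := sub_smul_dslope A 0 (qexp z)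
      rw [hA0, sub_zero, sub_zero, smul_eq_mul] at h
      rw [(hc z z.2).2, ← Pi.mul_apply (auxSeries k s P), ← hA, ← h, Pi.add_apply]
      simp only [Pi.mul_apply]
      field_simp)
  rw [mul_one] at heq
  rw [(hc τ hτ).1, heq, Pi.add_apply, dslope_same]
  simp [discSeries_zero]

lemma deriv_auxSeries_mul_auxSeries_zero (k l : ℂ) {P R : ℂ → ℂ}
    (hP : DifferentiableOn ℂ P (Metric.ball 0 1)) (hR : DifferentiableOn ℂ R (Metric.ball 0 1)) :
    deriv (auxSeries k 0 P * auxSeries l 0 R) 0 = 0 := by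
  have h := Metric.ball_mem_nhds (0 : ℂ) one_pos
  rw [deriv_mul ((differentiableOn_auxSeries k 0 hP).differentiableAt h)
    ((differentiableOn_auxSeries l 0 hR).differentiableAt h), auxSeries_zero, auxSeries_zero]
  ring

/-- Duality between the Kaneko–Zagier equations of weights `k` and `4-k`:
`(𝓕^{(k)})ᵀ · η⁻²⁴ C M C · 𝓕^{(4-k)} = diag(12k(4-k), (k+1)(5-k)/36)`. -/
theorem KZ_duality (k : ℝ) (hhalf : ∃ m : ℤ, k = m / 2) (hk0 : 0 < k) (hk4 : k < 4)
    (g₁k g₂k g₁k' g₂k' : ℂ → ℂ)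
    (hg₁k : DifferentiableOn ℂ g₁k (Metric.ball 0 1))
    (hg₂k : DifferentiableOn ℂ g₂k (Metric.ball 0 1))
    (hg₁k' : DifferentiableOn ℂ g₁k' (Metric.ball 0 1))
    (hg₂k' : DifferentiableOn ℂ g₂k' (Metric.ball 0 1))
    (hg₁k0 : g₁k 0 = 1) (hg₂k0 : g₂k 0 = 1) (hg₁k'0 : g₁k' 0 = 1) (hg₂k'0 : g₂k' 0 = 1)
    (hf₁k : SatisfiesKZ k (fun τ => g₁k (qexp τ)))
    (hf₂k : SatisfiesKZ k (fun τ => qpow ((k + 1) / 6) τ * g₂k (qexp τ)))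
    (hf₁k' : SatisfiesKZ (4 - k) (fun τ => g₁k' (qexp τ)))
    (hf₂k' : SatisfiesKZ (4 - k) (fun τ => qpow (((4 - k) + 1) / 6) τ * g₂k' (qexp τ))) :
    ∀ τ : ℂ, 0 < τ.im →
      (!![(-2 * (k : ℂ)) * g₁k (qexp τ),
          (-2 * (k : ℂ)) * (qpow ((k + 1) / 6) τ * g₂k (qexp τ));
          partialD (k : ℂ) (fun t => g₁k (qexp t)) τ,
          partialD (k : ℂ) (fun t => qpow ((k + 1) / 6) t * g₂k (qexp t)) τ])ᵀ *
        ((η τ ^ 24)⁻¹ •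
          (!![(-1 : ℂ)/24, 0; 0, 1] * !![E4 τ ^ 2, E6 τ; E6 τ, E4 τ] *
            !![(-1 : ℂ)/24, 0; 0, 1])) *
        (!![(-2 * ((4 : ℂ) - (k : ℂ))) * g₁k' (qexp τ),
            (-2 * ((4 : ℂ) - (k : ℂ))) * (qpow (((4 - k) + 1) / 6) τ * g₂k' (qexp τ));
            partialD ((4 : ℂ) - (k : ℂ)) (fun t => g₁k' (qexp t)) τ,
            partialD ((4 : ℂ) - (k : ℂ))
              (fun t => qpow (((4 - k) + 1) / 6) t * g₂k' (qexp t)) τ]) =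
      !![((12 * k * (4 - k) : ℝ) : ℂ), 0; 0, (((k + 1) * (5 - k) / 36 : ℝ) : ℂ)] := by
  intro τ hτ
  have hkl : k + (4 - k) = 4 := by ring
  have hq0 (P : ℂ → ℂ) : (fun t ↦ P (qexp t)) = fun t ↦ qpow 0 t * P (qexp t) := by
    simp only [qpow_zero, one_mul]
  have hη := pow_ne_zero 24 (eta_ne_zero hτ)
  rw [hq0] at hf₁k hf₁k'
  have h₁₁ := exists_dualityForm_qpow_eq_of_mul_eq_zero hkl (by simp) hg₁k hg₁k' hf₁k hf₁k'
    (a := 1) (by simp [qpow_zero]) hτ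
  have h₁₂ := exists_dualityForm_qpow_eq_of_mul_eq_zero hkl (by simp) hg₁k hg₂k' hf₁k hf₂k'
    (tendsto_qpow_atImInfty (by linarith)) hτ
  have h₂₁ := exists_dualityForm_qpow_eq_of_mul_eq_zero hkl (by simp) hg₂k hg₁k' hf₂k hf₁k'
    (tendsto_qpow_atImInfty (by linarith)) hτ
  have h₂₂ := dualityForm_eq_of_add_eq_one hkl (by ring) hg₂k hg₂k' hg₂k0 hg₂k'0 hf₂k hf₂k' hτ
  rw [Complex.ofReal_zero, deriv_auxSeries_mul_auxSeries_zero _ _ hg₁k hg₁k', hg₁k0, hg₁k'0] at h₁₁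
  rw [← hq0, ← hq0] at h₁₁
  rw [← hq0] at h₁₂ h₂₁
  simp only [dualityForm] at h₁₁ h₁₂ h₂₁ h₂₂
  push_cast at h₁₁ h₁₂ h₂₁ h₂₂ ⊢
  rw [← div_eq_iff hη] at h₁₁ h₁₂ h₂₁ h₂₂
  ext i j
  fin_cases i <;> fin_cases j <;> simp [Matrix.mul_apply, Fin.sum_univ_two]
  · linear_combination h₁₁
  · linear_combination h₁₂
  · linear_combination h₂₁
  · linear_combination h₂₂
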